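/- Let d ≥ 1, 1 ≤ p < 2 and 1 ≤ q ≤ ∞. Let f be the tempered distribution on ℝ^d whose Fourier transform is 𝓕f(ξ) = χ_{{|ξ|≤1}}(ξ) |ξ|^{−d/2}. Then f ∈ ŵ^{p,q}(ℝ^d) but f ∉ L²(ℝ^d); in particular ŵ^{p,q}(ℝ^d) contains elements of infinite L²-norm. -/

import Mathlib

open MeasureTheory Filter Complex
open scoped ENNReal FourierTransform ComplexConjugate

noncomputable section

abbrev Rd (d : ℕ) := EuclideanSpace ℝ (Fin d)

/-- The cube `n + (-1/2, 1/2]^d` in frequency space. -/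
def unitCube {d : ℕ} (n : Fin d → ℤ) : Set (Rd d) :=
  {ξ | ∀ i, (n i : ℝ) - 1/2 < ξ i ∧ ξ i ≤ (n i : ℝ) + 1/2}

/-- `ℓ^q` norm of an `ℝ≥0∞`-valued family. -/
def lqNorm {α : Type*} (q : ℝ≥0∞) (a : α → ℝ≥0∞) : ℝ≥0∞ :=
  if q = ∞ then ⨆ n, a n else (∑' n, a n ^ q.toReal) ^ (1 / q.toReal)

/-- Fourier-side amalgam norm with weight `⟨n⟩^s`, applied to a function `F`
playing the role of the Fourier transform of the distribution. -/
def amalgamNormF (d : ℕ) (p q : ℝ≥0∞) (s : ℝ) (F : Rd d → ℂ) : ℝ≥0∞ :=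
  lqNorm q (fun n : Fin d → ℤ =>
    eLpNorm ((unitCube n).indicator F) p volume
      * ENNReal.ofReal ((1 + ∑ i, ((n i : ℝ)) ^ 2) ^ (s / 2)))

/-- Fourier amalgam norm `‖f‖_{ŵ_s^{p,q}}`. -/
def amalgamNorm (d : ℕ) (p q : ℝ≥0∞) (s : ℝ) (f : Rd d → ℂ) : ℝ≥0∞ :=
  amalgamNormF d p q s (𝓕 f)

/-- Fourier–Lebesgue norm `‖f‖_{𝓕L^r}`. -/
def fourierLebesgueNorm (d : ℕ) (r : ℝ≥0∞) (f : Rd d → ℂ) : ℝ≥0∞ :=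
  eLpNorm (𝓕 f) r volume

/-- Convolution of two complex-valued functions on `ℝ^d`. -/
def conv {d : ℕ} (f g : Rd d → ℂ) : Rd d → ℂ :=
  MeasureTheory.convolution f g (ContinuousLinearMap.mul ℝ ℂ) volume

/-- The Hartree kernel `K(x) = λ |x|^{-γ}`. -/
def hartreeK (d : ℕ) (lam γ : ℝ) : Rd d → ℂ := fun x => ((lam * ‖x‖ ^ (-γ) : ℝ) : ℂ)

/-- The Hartree trilinear nonlinearity `H_γ(f,g,h) = (K ∗ (f ḡ)) h`. -/
def hartreeH (d : ℕ) (lam γ : ℝ) (f g h : Rd d → ℂ) : Rd d → ℂ :=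
  fun x => conv (hartreeK d lam γ) (fun y => f y * (starRingEnd ℂ) (g y)) x * h x

theorem measurable_truncated_norm_rpow (d : ℕ) (a : ℝ) :
    Measurable (fun ξ : Rd d => if ‖ξ‖ ≤ 1 then ((‖ξ‖ ^ a : ℝ) : ℂ) else 0) :=
  Measurable.ite (measurableSet_le measurable_norm measurable_const)
    (Complex.measurable_ofReal.comp (measurable_norm.pow_const a)) measurable_const

theorem memLp_truncated_norm_rpow_iff {d : ℕ} (hd : 1 ≤ d) (a : ℝ) {r : ℝ≥0∞}
    (hr0 : r ≠ 0) (hr : r ≠ ∞) :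
    MemLp (fun ξ : Rd d => if ‖ξ‖ ≤ 1 then ((‖ξ‖ ^ a : ℝ) : ℂ) else 0) r volume ↔
      -(d : ℝ) < a * r.toReal := by
  have hr' : 0 < r.toReal := ENNReal.toReal_pos hr0 hr
  have : Nonempty (Fin d) := ⟨⟨0, hd⟩⟩
  rw [← integrable_norm_rpow_iff (measurable_truncated_norm_rpow d a).aestronglyMeasurable hr0 hr]
  have hnorm : (fun ξ : Rd d => ‖(if ‖ξ‖ ≤ 1 then ((‖ξ‖ ^ a : ℝ) : ℂ) else 0)‖ ^ r.toReal) =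
      fun ξ : Rd d => (Set.Iic (1 : ℝ)).indicator (fun y => (|y ^ a|) ^ r.toReal) ‖ξ‖ := by
    ext ξ
    by_cases h : ‖ξ‖ ≤ 1
    · simp only [h, if_true, Complex.norm_real, Real.norm_eq_abs, Set.mem_Iic,
        Set.indicator_of_mem]
    · simp [h, hr'.ne']
  have hpow : ∀ y ∈ Set.Ioi (0 : ℝ),
      y ^ (d - 1) • (Set.Iic (1 : ℝ)).indicator (fun y => (|y ^ a|) ^ r.toReal) y =
        (Set.Iic (1 : ℝ)).indicator (fun y => y ^ ((d : ℝ) - 1 + a * r.toReal)) y := by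
    intro y (hy : 0 < y)
    by_cases h : y ≤ 1
    · simp only [Set.mem_Iic, h, Set.indicator_of_mem, smul_eq_mul]
      rw [abs_of_pos (Real.rpow_pos_of_pos hy a), ← Real.rpow_mul hy.le, ← Real.rpow_natCast,
        ← Real.rpow_add hy, Nat.cast_sub hd, Nat.cast_one]
    · simp [h]
  rw [hnorm, integrable_fun_norm_addHaar, finrank_euclideanSpace_fin,
    integrableOn_congr_fun hpow measurableSet_Ioi, IntegrableOn,
    integrable_indicator_iff measurableSet_Iic, IntegrableOn,
    Measure.restrict_restrict measurableSet_Iic, Set.inter_comm, Set.Ioi_inter_Iic,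
    ← IntegrableOn, integrableOn_Ioc_iff_integrableOn_Ioo,
    intervalIntegral.integrableOn_Ioo_rpow_iff one_pos]
  constructor <;> intro h <;> linarith

theorem norm_gt_one_of_mem_unitCube {d : ℕ} {n : Fin d → ℤ} (hn : n ∉ Set.Icc (-1) 1)
    {ξ : Rd d} (hξ : ξ ∈ unitCube n) : 1 < ‖ξ‖ := by
  contrapose! hn
  have hcoord (i : Fin d) : |ξ i| ≤ 1 := (PiLp.norm_apply_le ξ i).trans hn
  refine ⟨fun i => ?_, fun i => ?_⟩
  · have h := (abs_le.1 (hcoord i)).1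
    have : (-2 : ℝ) < n i := by linarith [(hξ i).2]
    have : -2 < n i := by exact_mod_cast this
    simp only [Pi.neg_apply, Pi.one_apply]
    omega
  · have h := (abs_le.1 (hcoord i)).2
    have : (n i : ℝ) < 2 := by linarith [(hξ i).1]
    have : n i < 2 := by exact_mod_cast this
    simp only [Pi.one_apply]
    omega

theorem lqNorm_lt_top_of_support_subset {α : Type*} {q : ℝ≥0∞} (hq : q ≠ 0) {a : α → ℝ≥0∞}
    {C : ℝ≥0∞} (hC : C < ∞) (haC : ∀ n, a n ≤ C) (s : Finset α) (hs : ∀ n ∉ s, a n = 0) :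
    lqNorm q a < ∞ := by
  rw [lqNorm]
  split_ifs with h
  · exact (iSup_le haC).trans_lt hC
  · have hq' : 0 < q.toReal := ENNReal.toReal_pos hq h
    refine ENNReal.rpow_lt_top_of_nonneg (by positivity) (ne_of_lt ?_)
    rw [tsum_eq_sum (s := s) fun n hn => by rw [hs n hn, ENNReal.zero_rpow_of_pos hq']]
    exact ENNReal.sum_lt_top.2 fun n _ =>
      ENNReal.rpow_lt_top_of_nonneg hq'.le ((haC n).trans_lt hC).ne

/-- an element of `ŵ^{p,q}` with infinite `L²` norm.
For `1 ≤ p < 2`, `1 ≤ q ≤ ∞`, the tempered distribution `f` with Fourier transform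
`𝓕f(ξ) = χ_{{|ξ|≤1}}(ξ)|ξ|^{-d/2}` lies in `ŵ^{p,q}(ℝ^d)` but (by Plancherel,
since `𝓕f ∉ L²`) not in `L²(ℝ^d)`. -/
theorem amalgam_infinite_L2_example (d : ℕ) (hd : 1 ≤ d) (p q : ℝ≥0∞)
    (hp1 : 1 ≤ p) (hp2 : p < 2) (hq : 1 ≤ q) :
    amalgamNormF d p q 0
        (fun ξ : Rd d => if ‖ξ‖ ≤ 1 then ((‖ξ‖ ^ (-(d : ℝ)/2) : ℝ) : ℂ) else 0) < ∞ ∧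
    eLpNorm (fun ξ : Rd d => if ‖ξ‖ ≤ 1 then ((‖ξ‖ ^ (-(d : ℝ)/2) : ℝ) : ℂ) else 0)
        2 volume = ∞ := by
  have hp0 : p ≠ 0 := (zero_lt_one.trans_le hp1).ne'
  have hptop : p ≠ ∞ := (hp2.trans ENNReal.ofNat_lt_top).ne
  have hp2' : p.toReal < 2 := by
    simpa using (ENNReal.toReal_lt_toReal hptop ENNReal.ofNat_ne_top).2 hp2
  have hd' : (0 : ℝ) < d := by exact_mod_cast hd
  constructor
  · have hmem := (memLp_truncated_norm_rpow_iff hd (-(d : ℝ) / 2) hp0 hptop).2 (by nlinarith)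
    refine lqNorm_lt_top_of_support_subset (zero_lt_one.trans_le hq).ne' hmem.2 (fun n => ?_)
      (Finset.Icc (-1) 1) fun n hn => ?_
    · simpa using eLpNorm_indicator_le _
    · rw [Finset.mem_Icc, ← Set.mem_Icc] at hn
      rw [Set.indicator_eq_zero'.2, eLpNorm_zero, zero_mul]
      refine Set.disjoint_left.2 fun ξ hξ hcube => ?_
      simp [(norm_gt_one_of_mem_unitCube hn hcube).not_ge] at hξ
  · by_contra h
    have hmem := (memLp_truncated_norm_rpow_iff hd (-(d : ℝ) / 2) two_ne_zero
      ENNReal.ofNat_ne_top).1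
        ⟨(measurable_truncated_norm_rpow d _).aestronglyMeasurable, lt_top_iff_ne_top.2 h⟩
    simp at hmem
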